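/- Let k ≥ 0, r = k + 1, and 0 ≤ s ≤ k. Suppose a_2 is (s+1)-times continuously differentiable with a_2(x) ≥ a_min > 0 on [a,b] and a_0 is continuous with a_0 ≥ 0. There exists a constant C > 0, independent of the partition, such that for every partition a = x_1 < … < x_N = b, if u is (s+2)-times continuously differentiable on [a,b], solves −(a_2 u′)′ + a_0 u = f on (a,b) with u(a) = 0, u′(b) = 0, and u_h ∈ S_h is the weak finite element solution with nodal values u_h^i, then max_{1≤i≤N} |u_h^i − u(x_i)| ≤ C h^{s+1} ‖u‖_{s+2}, where h is the mesh size. -/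

import Mathlib

open MeasureTheory Set

noncomputable section

/-- `p` is the discrete weak derivative of order `r` of the weak function
`(v0, vl, vr)` on the interval `(c, d)`: it is a polynomial of degree at most `r`
satisfying `∫ p q = -∫ v0 q' + vr q(d) - vl q(c)` for all polynomials `q` of
degree at most `r`. -/
def IsWeakDeriv (r : ℕ) (c d : ℝ) (v0 : ℝ → ℝ) (vl vr : ℝ) (p : Polynomial ℝ) : Prop :=
  p.degree ≤ (r : WithBot ℕ) ∧ ∀ q : Polynomial ℝ, q.degree ≤ (r : WithBot ℕ) →
    (∫ t in c..d, p.eval t * q.eval t) =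
      -(∫ t in c..d, v0 t * q.derivative.eval t) + vr * q.eval d - vl * q.eval c

/-- `p` is the L²(c,d)-orthogonal projection of `g` onto polynomials of degree at most `l`. -/
def IsL2Proj (l : ℕ) (c d : ℝ) (g : ℝ → ℝ) (p : Polynomial ℝ) : Prop :=
  p.degree ≤ (l : WithBot ℕ) ∧ ∀ q : Polynomial ℝ, q.degree ≤ (l : WithBot ℕ) →
    (∫ t in c..d, (g t - p.eval t) * q.eval t) = 0

/-- `x 0 = a < x 1 < ⋯ < x (N-1) = b` is a partition of `(a,b)`. -/
def IsPartition (N : ℕ) (a b : ℝ) (x : ℕ → ℝ) : Prop :=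
  2 ≤ N ∧ x 0 = a ∧ x (N - 1) = b ∧ ∀ i < N - 1, x i < x (i + 1)

/-- Membership in the weak finite element space `S_h`: on each of the `N - 1` elements the
interior component is a polynomial of degree at most `k`, the nodal values are single
valued, and the nodal value at the left endpoint vanishes. -/
def MemSh (k N : ℕ) (v0 : ℕ → Polynomial ℝ) (vn : ℕ → ℝ) : Prop :=
  (∀ i < N - 1, (v0 i).degree ≤ (k : WithBot ℕ)) ∧ vn 0 = 0

/-- `D i` is the discrete weak derivative of order `r` of the weak finite element function
`(v0, vn)` on the `i`-th element `(x i, x (i+1))`. -/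
def IsWeakDerivFam (r N : ℕ) (x : ℕ → ℝ) (v0 : ℕ → Polynomial ℝ) (vn : ℕ → ℝ)
    (D : ℕ → Polynomial ℝ) : Prop :=
  ∀ i < N - 1, IsWeakDeriv r (x i) (x (i + 1)) (fun t => (v0 i).eval t) (vn i) (vn (i + 1)) (D i)

/-- `(u0, un)` with discrete weak derivatives `Du` is a weak finite element solution:
it belongs to `S_h` and satisfies
`(a2 d_w u_h, d_w v)_h + (a0 u_h⁰, v⁰) = (f, v⁰)` for all `v ∈ S_h`. -/
def IsWFESol (k r N : ℕ) (x : ℕ → ℝ) (a2 a0 f : ℝ → ℝ)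
    (u0 : ℕ → Polynomial ℝ) (un : ℕ → ℝ) (Du : ℕ → Polynomial ℝ) : Prop :=
  MemSh k N u0 un ∧ IsWeakDerivFam r N x u0 un Du ∧
  ∀ (v0 : ℕ → Polynomial ℝ) (vn : ℕ → ℝ) (Dv : ℕ → Polynomial ℝ),
    MemSh k N v0 vn → IsWeakDerivFam r N x v0 vn Dv →
    ((∑ i ∈ Finset.range (N - 1), ∫ t in x i..x (i + 1), a2 t * (Du i).eval t * (Dv i).eval t)
      + ∑ i ∈ Finset.range (N - 1), ∫ t in x i..x (i + 1), a0 t * (u0 i).eval t * (v0 i).eval t)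
      = ∑ i ∈ Finset.range (N - 1), ∫ t in x i..x (i + 1), f t * (v0 i).eval t

/-- The Sobolev norm `‖u‖_m = (∑_{j=0}^m ∫_a^b |u^{(j)}|² dx)^{1/2}` of an `m`-times
continuously differentiable function on `[a,b]`. -/
def sobNorm (m : ℕ) (a b : ℝ) (u : ℝ → ℝ) : ℝ :=
  Real.sqrt (∑ j ∈ Finset.range (m + 1),
    ∫ t in a..b, (iteratedDerivWithin j u (Set.Icc a b) t) ^ 2)

/-- `u` solves the two-point boundary value problem
`-(a2 u')' + a0 u = f` on `(a,b)`, `u(a) = 0`, `u'(b) = 0`. -/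
def SolvesBVP (a b : ℝ) (a2 a0 f u : ℝ → ℝ) : Prop :=
  (∀ x ∈ Set.Ioo a b,
    -(derivWithin (fun t => a2 t * derivWithin u (Set.Icc a b) t) (Set.Icc a b) x)
      + a0 x * u x = f x) ∧
  u a = 0 ∧ derivWithin u (Set.Icc a b) b = 0

theorem aux_deg_iff (p : Polynomial ℝ) (k : ℕ) :
    p.degree ≤ (k : WithBot ℕ) ↔ p.degree < ((k + 1 : ℕ) : WithBot ℕ) := by
  rw [Polynomial.degree_lt_iff_coeff_zero, Polynomial.degree_le_iff_coeff_zero]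
  constructor
  · intro h m hm
    exact h m (by exact_mod_cast hm)
  · intro h m hm
    exact h m (by exact_mod_cast hm)

theorem aux_ii {c d : ℝ} (hcd : c ≤ d) {g : ℝ → ℝ} (hg : ContinuousOn g (Icc c d)) :
    IntervalIntegrable g volume c d := by
  apply ContinuousOn.intervalIntegrable
  rwa [uIcc_of_le hcd]

/-- Cauchy-Schwarz against the constant function. -/
theorem aux_cs {c d : ℝ} (hcd : c ≤ d) {g : ℝ → ℝ} (hg : ContinuousOn g (Icc c d)) :
    (∫ t in c..d, g t) ^ 2 ≤ (d - c) * ∫ t in c..d, g t ^ 2 := by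
  rcases hcd.eq_or_lt with rfl | hlt
  · simp
  have h1 : ∀ l : ℝ, 0 ≤ (∫ t in c..d, g t ^ 2) - 2 * l * (∫ t in c..d, g t) + l ^ 2 * (d - c) := by
    intro l
    have h2 : 0 ≤ ∫ t in c..d, (g t - l) ^ 2 :=
      intervalIntegral.integral_nonneg hcd (fun t _ => sq_nonneg _)
    have h3 : ∫ t in c..d, (g t - l) ^ 2 =
        ∫ t in c..d, ((g t ^ 2 - 2 * l * g t) + l ^ 2) := by
      congr 1; ext t; ring
    rw [h3, intervalIntegral.integral_add (aux_ii hcd (by fun_prop)) (aux_ii hcd (by fun_prop)),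
      intervalIntegral.integral_sub (aux_ii hcd (by fun_prop)) (aux_ii hcd (by fun_prop)),
      intervalIntegral.integral_const_mul, intervalIntegral.integral_const, smul_eq_mul] at h2
    linarith
  have hd : 0 < d - c := by linarith
  have h4 := h1 ((∫ t in c..d, g t) / (d - c))
  have h5 : (d - c) * ((∫ t in c..d, g t ^ 2) - 2 * ((∫ t in c..d, g t) / (d - c)) *
      (∫ t in c..d, g t) + ((∫ t in c..d, g t) / (d - c)) ^ 2 * (d - c)) =
      (d - c) * (∫ t in c..d, g t ^ 2) - (∫ t in c..d, g t) ^ 2 := by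
    field_simp; ring
  have h6 := mul_nonneg hd.le h4
  rw [h5] at h6
  linarith

/-- Pointwise bound of the increment by the derivative. -/
theorem aux_pt {c d : ℝ} (hcd : c ≤ d) {F g : ℝ → ℝ} (hF : ContinuousOn F (Icc c d))
    (hg : ContinuousOn g (Icc c d)) (hd : ∀ t ∈ Ioo c d, HasDerivAt F (g t) t)
    {t : ℝ} (ht : t ∈ Icc c d) :
    (F t - F c) ^ 2 ≤ (d - c) * ∫ t in c..d, g t ^ 2 := by
  have hsub : Icc c t ⊆ Icc c d := Icc_subset_Icc le_rfl ht.2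
  have h1 : ∫ y in c..t, g y = F t - F c :=
    intervalIntegral.integral_eq_sub_of_hasDerivAt_of_le ht.1 (hF.mono hsub)
      (fun y hy => hd y ⟨hy.1, hy.2.trans_le ht.2⟩) (aux_ii ht.1 (hg.mono hsub))
  rw [← h1]
  refine (aux_cs ht.1 (hg.mono hsub)).trans ?_
  have h2 : ∫ y in c..t, g y ^ 2 ≤ ∫ y in c..d, g y ^ 2 := by
    rw [← intervalIntegral.integral_add_adjacent_intervals
      (f := fun y => g y ^ 2) (aux_ii ht.1 ((hg.mono hsub).pow 2))
      (aux_ii ht.2 ((hg.mono (Icc_subset_Icc ht.1 le_rfl)).pow 2))]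
    have := intervalIntegral.integral_nonneg (μ := volume) (f := fun y => g y ^ 2) ht.2
      (fun y _ => sq_nonneg _)
    linarith
  have h3 : 0 ≤ ∫ y in c..t, g y ^ 2 :=
    intervalIntegral.integral_nonneg ht.1 (fun y _ => sq_nonneg _)
  apply mul_le_mul _ h2 h3 (by linarith)
  linarith [ht.2]

theorem aux_poincare {c d : ℝ} (hcd : c ≤ d) {F g : ℝ → ℝ} (hF : ContinuousOn F (Icc c d))
    (hg : ContinuousOn g (Icc c d)) (hd : ∀ t ∈ Ioo c d, HasDerivAt F (g t) t) :
    ∫ t in c..d, (F t - F c) ^ 2 ≤ (d - c) ^ 2 * ∫ t in c..d, g t ^ 2 := by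
  have h1 : ∫ t in c..d, (F t - F c) ^ 2 ≤
      ∫ t in c..d, ((d - c) * ∫ t in c..d, g t ^ 2) := by
    apply intervalIntegral.integral_mono_on hcd (aux_ii hcd (by fun_prop))
      (aux_ii hcd (by fun_prop))
    intro t ht
    exact aux_pt hcd hF hg hd ht
  rw [intervalIntegral.integral_const, smul_eq_mul] at h1
  linarith

/-- Polynomial antiderivative. -/
theorem aux_anti (p : Polynomial ℝ) (m : ℕ) (hp : p.degree < (m : WithBot ℕ)) (c v : ℝ) :
    ∃ P : Polynomial ℝ, P.derivative = p ∧ P.eval c = v ∧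
      P.degree < ((m + 1 : ℕ) : WithBot ℕ) := by
  classical
  set Q : Polynomial ℝ := ∑ i ∈ Finset.range m, Polynomial.monomial (i + 1) (p.coeff i / (i + 1))
    with hQ
  have hQd : Q.derivative = p := by
    ext n
    rw [Polynomial.coeff_derivative, hQ]
    simp only [Polynomial.finsetSum_coeff, Polynomial.coeff_monomial, add_left_inj]
    rw [Finset.sum_ite_eq' ]
    split_ifs with h
    · have : (n : ℝ) + 1 ≠ 0 := by positivity
      field_simp
    · rw [Polynomial.degree_lt_iff_coeff_zero] at hp
      rw [hp n (by simpa using h)]; ring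
  refine ⟨Q + Polynomial.C (v - Q.eval c), by simp [hQd], by simp, ?_⟩
  rw [Polynomial.degree_lt_iff_coeff_zero]
  intro n hn
  have hn0 : n ≠ 0 := by omega
  rw [Polynomial.coeff_add, Polynomial.coeff_C_of_ne_zero hn0, hQ]
  simp only [Polynomial.finsetSum_coeff, Polynomial.coeff_monomial]
  rw [add_zero]
  apply Finset.sum_eq_zero
  intro i hi
  rw [if_neg]
  have := Finset.mem_range.1 hi
  omega

/-- Polynomial approximation of order `m` on an interval. -/
theorem aux_taylor {c d : ℝ} (hcd : c ≤ d) (m : ℕ) : ∀ G : ℕ → ℝ → ℝ,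
    (∀ j ≤ m, ContinuousOn (G j) (Icc c d)) →
    (∀ j < m, ∀ t ∈ Ioo c d, HasDerivAt (G j) (G (j + 1) t) t) →
    ∃ T : Polynomial ℝ, T.degree < (m : WithBot ℕ) ∧
      ∫ t in c..d, (G 0 t - T.eval t) ^ 2 ≤ (d - c) ^ (2 * m) * ∫ t in c..d, G m t ^ 2 := by
  induction m with
  | zero =>
    intro G _ _
    exact ⟨0, by simp, by simp⟩
  | succ m ih =>
    intro G hc hd
    obtain ⟨T, hT, hTe⟩ := ih (fun j => G (j + 1)) (fun j hj => hc _ (by omega))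
      (fun j hj => hd _ (by omega))
    obtain ⟨P, hP, hPc, hPd⟩ := aux_anti T m hT c (G 0 c)
    refine ⟨P, hPd, ?_⟩
    have h0 := hc 0 (by omega)
    have h1 := hc 1 (by omega)
    have := aux_poincare hcd (F := fun t => G 0 t - P.eval t) (g := fun t => G 1 t - T.eval t)
      (h0.sub P.continuous.continuousOn) (h1.sub T.continuous.continuousOn)
      (fun t ht => by
        have := (hd 0 (by omega) t ht).sub (P.hasDerivAt t)
        rw [hP] at this
        exact this)
    simp only [hPc, sub_self, sub_zero] at this
    refine this.trans ?_
    have h2 := mul_le_mul_of_nonneg_left hTe (sq_nonneg (d - c))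
    simp only [zero_add] at h2
    refine h2.trans (le_of_eq ?_)
    ring

/-- L² projection of a polynomial. -/
theorem aux_proj {c d : ℝ} (hcd : c < d) (k : ℕ) (P : Polynomial ℝ) :
    ∃ p : Polynomial ℝ, p.degree ≤ (k : WithBot ℕ) ∧ ∀ q : Polynomial ℝ,
      q.degree ≤ (k : WithBot ℕ) → ∫ t in c..d, (P.eval t - p.eval t) * q.eval t = 0 := by
  have hii : ∀ p q : Polynomial ℝ,
      IntervalIntegrable (fun t => p.eval t * q.eval t) volume c d := fun p q =>
    (p.continuous.mul q.continuous).intervalIntegrable _ _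
  let B : Polynomial ℝ →ₗ[ℝ] Polynomial ℝ →ₗ[ℝ] ℝ := LinearMap.mk₂ ℝ
    (fun p q => ∫ t in c..d, p.eval t * q.eval t)
    (by
      intro p p' q
      rw [← intervalIntegral.integral_add (hii _ _) (hii _ _)]
      congr 1; ext t; simp; ring)
    (by
      intro r p q
      rw [smul_eq_mul, ← intervalIntegral.integral_const_mul]
      congr 1; ext t; simp; ring)
    (by
      intro p q q'
      rw [← intervalIntegral.integral_add (hii _ _) (hii _ _)]
      congr 1; ext t; simp; ring)
    (by
      intro r p q
      rw [smul_eq_mul, ← intervalIntegral.integral_const_mul]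
      congr 1; ext t; simp; ring)
  let V := Polynomial.degreeLT ℝ (k + 1)
  let L : V →ₗ[ℝ] Module.Dual ℝ V := (B.domRestrict₁₂ V V)
  have hfd : FiniteDimensional ℝ V :=
    Module.Finite.equiv (Polynomial.degreeLTEquiv ℝ (k + 1)).symm
  have hinj : Function.Injective L := by
    rw [injective_iff_map_eq_zero]
    intro p hp
    have h1 : ∫ t in c..d, (p : Polynomial ℝ).eval t * (p : Polynomial ℝ).eval t = 0 := by
      have := LinearMap.congr_fun hp p
      exact this
    by_contra hne
    have hex : ∃ y ∈ Icc c d, 0 < (p : Polynomial ℝ).eval y * (p : Polynomial ℝ).eval y := by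
      by_contra hno
      push Not at hno
      apply hne
      apply Subtype.ext
      apply Polynomial.eq_zero_of_infinite_isRoot
      apply Set.Infinite.mono _ (Icc_infinite hcd)
      intro y hy
      have := hno y hy
      exact mul_self_eq_zero.1 (le_antisymm this (mul_self_nonneg _))
    have := intervalIntegral.integral_pos hcd
      ((p : Polynomial ℝ).continuous.mul (p : Polynomial ℝ).continuous).continuousOn
      (fun y _ => mul_self_nonneg _) hex
    exact this.ne' h1
  have hsurj := (LinearMap.injective_iff_surjective_of_finrank_eq_finrank
    (Subspace.dual_finrank_eq (K := ℝ) (V := V)).symm).1 hinj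
  obtain ⟨p, hp⟩ := hsurj ((B P).domRestrict V)
  refine ⟨p, (aux_deg_iff _ _).2 (Polynomial.mem_degreeLT.1 p.2), ?_⟩
  intro q hq
  have hqV : q ∈ V := Polynomial.mem_degreeLT.2 ((aux_deg_iff _ _).1 hq)
  have h1 : ∫ t in c..d, (p : Polynomial ℝ).eval t * q.eval t =
      ∫ t in c..d, P.eval t * q.eval t := LinearMap.congr_fun hp ⟨q, hqV⟩
  have h2 : ∫ t in c..d, (P.eval t - (p : Polynomial ℝ).eval t) * q.eval t =
      ∫ t in c..d, (P.eval t * q.eval t - (p : Polynomial ℝ).eval t * q.eval t) := by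
    congr 1; ext t; ring
  rw [h2, intervalIntegral.integral_sub (hii _ _) (hii _ _), h1, sub_self]

theorem aux_best {c d : ℝ} (hcd : c ≤ d) (k : ℕ) (P p R : Polynomial ℝ)
    (hp : p.degree ≤ (k : WithBot ℕ)) (hR : R.degree ≤ (k : WithBot ℕ))
    (hproj : ∀ q : Polynomial ℝ, q.degree ≤ (k : WithBot ℕ) →
      ∫ t in c..d, (P.eval t - p.eval t) * q.eval t = 0) :
    ∫ t in c..d, (P.eval t - p.eval t) ^ 2 ≤ ∫ t in c..d, (P.eval t - R.eval t) ^ 2 := by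
  have h0 := hproj (p - R) ((Polynomial.degree_sub_le _ _).trans (max_le hp hR))
  have h1 : ∫ t in c..d, (P.eval t - R.eval t) ^ 2 = ∫ t in c..d,
      (((P.eval t - p.eval t) ^ 2 + 2 * ((P.eval t - p.eval t) * (p - R).eval t))
        + (p.eval t - R.eval t) ^ 2) := by
    congr 1; ext t; simp; ring
  have h2 : 0 ≤ ∫ t in c..d, (p.eval t - R.eval t) ^ 2 :=
    intervalIntegral.integral_nonneg hcd (fun t _ => sq_nonneg _)
  rw [h1, intervalIntegral.integral_add (aux_ii hcd (by fun_prop)) (aux_ii hcd (by fun_prop)),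
    intervalIntegral.integral_add (aux_ii hcd (by fun_prop)) (aux_ii hcd (by fun_prop)),
    intervalIntegral.integral_const_mul, h0]
  linarith

theorem aux_iip (c d : ℝ) (p q : Polynomial ℝ) :
    IntervalIntegrable (fun t => p.eval t * q.eval t) volume c d :=
  (p.continuous.mul q.continuous).intervalIntegrable _ _

theorem aux_ibp (c d : ℝ) (E q : Polynomial ℝ) :
    ∫ t in c..d, E.derivative.eval t * q.eval t =
      -(∫ t in c..d, E.eval t * q.derivative.eval t) + E.eval d * q.eval d
        - E.eval c * q.eval c := by
  have := intervalIntegral.integral_deriv_mul_eq_sub (a := c) (b := d)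
    (u := fun t => E.eval t) (v := fun t => q.eval t) (u' := fun t => E.derivative.eval t)
    (v' := fun t => q.derivative.eval t) (fun t _ => E.hasDerivAt t) (fun t _ => q.hasDerivAt t)
    (E.derivative.continuous.intervalIntegrable _ _)
    (q.derivative.continuous.intervalIntegrable _ _)
  rw [intervalIntegral.integral_add (aux_iip _ _ _ _) (aux_iip _ _ _ _)] at this
  linarith

theorem aux_split (c d : ℝ) (E p q : Polynomial ℝ) :
    ∫ t in c..d, (E.eval t - p.eval t) * q.eval t =
      (∫ t in c..d, E.eval t * q.eval t) - ∫ t in c..d, p.eval t * q.eval t := by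
  rw [← intervalIntegral.integral_sub (aux_iip _ _ _ _) (aux_iip _ _ _ _)]
  congr 1; ext t; ring

theorem aux_wd {c d : ℝ} (k : ℕ) {v0 D E : Polynomial ℝ} {vl vr : ℝ}
    (h : IsWeakDeriv (k + 1) c d (fun t => v0.eval t) vl vr D) (hE : E.derivative = D)
    (hEc : E.eval c = vl) :
    E.eval d = vr ∧ ∀ q : Polynomial ℝ, q.degree ≤ (k : WithBot ℕ) →
      ∫ t in c..d, (E.eval t - v0.eval t) * q.eval t = 0 := by
  subst hE
  have h1 : E.eval d = vr := by
    have h2 := h.2 1 (Polynomial.degree_one_le.trans (by positivity))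
    rw [aux_ibp] at h2
    simp at h2
    linarith
  refine ⟨h1, fun q hq => ?_⟩
  obtain ⟨Q, hQ, -, hQd⟩ := aux_anti q (k + 1) ((aux_deg_iff _ _).1 hq) c 0
  have h2 := h.2 Q ((aux_deg_iff _ _).2 hQd)
  rw [aux_ibp, h1, hEc, hQ] at h2
  rw [aux_split]
  linarith

theorem aux_wd' {c d : ℝ} (k : ℕ) {v0 D E : Polynomial ℝ}
    (hD : D.degree ≤ ((k + 1 : ℕ) : WithBot ℕ)) (hE : E.derivative = D)
    (h : ∀ q : Polynomial ℝ, q.degree ≤ (k : WithBot ℕ) →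
      ∫ t in c..d, (E.eval t - v0.eval t) * q.eval t = 0) :
    IsWeakDeriv (k + 1) c d (fun t => v0.eval t) (E.eval c) (E.eval d) D := by
  refine ⟨hD, fun q hq => ?_⟩
  have h1 := h q.derivative (by
    rw [Polynomial.degree_le_iff_coeff_zero] at hq ⊢
    intro m hm
    rw [Polynomial.coeff_derivative, hq (m + 1), zero_mul]
    have : k < m := by exact_mod_cast hm
    exact_mod_cast Nat.succ_lt_succ this)
  rw [aux_split] at h1
  rw [← hE, aux_ibp]
  linarith

theorem aux_wd_sub {c d : ℝ} (r : ℕ) {v0 D v0' D' : Polynomial ℝ} {vl vr vl' vr' : ℝ}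
    (h : IsWeakDeriv r c d (fun t => v0.eval t) vl vr D)
    (h' : IsWeakDeriv r c d (fun t => v0'.eval t) vl' vr' D') :
    IsWeakDeriv r c d (fun t => (v0 - v0').eval t) (vl - vl') (vr - vr') (D - D') := by
  refine ⟨(Polynomial.degree_sub_le _ _).trans (max_le h.1 h'.1), fun q hq => ?_⟩
  have h1 := h.2 q hq
  have h2 := h'.2 q hq
  simp only [Polynomial.eval_sub]
  rw [aux_split, aux_split]
  linarith

set_option maxHeartbeats 2000000 in
/-- Energy inequality on one element. -/
theorem aux_elem {c d h amin A2 A0 : ℝ} (hcd : c < d) (hh : d - c ≤ h) (hamin : 0 < amin)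
    (k : ℕ) {a2 a0 f u u1 w : ℝ → ℝ}
    (ca2 : ContinuousOn a2 (Icc c d)) (ca0 : ContinuousOn a0 (Icc c d))
    (cu : ContinuousOn u (Icc c d)) (cu1 : ContinuousOn u1 (Icc c d))
    (cw : ContinuousOn w (Icc c d))
    (hw : ∀ t ∈ Ioo c d, HasDerivAt (fun t => a2 t * u1 t) (w t) t)
    (hf : ∀ t ∈ Ioo c d, f t = -w t + a0 t * u t)
    (ba2 : ∀ t ∈ Icc c d, amin ≤ a2 t ∧ a2 t ≤ A2)
    (ba0 : ∀ t ∈ Icc c d, 0 ≤ a0 t ∧ a0 t ≤ A0)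
    (Du p u0 I0 E T : Polynomial ℝ) (hE : E.derivative = Du - p)
    (he0 : (u0 - I0).degree ≤ (k : WithBot ℕ))
    (hproj : ∀ q : Polynomial ℝ, q.degree ≤ (k : WithBot ℕ) →
      ∫ t in c..d, (E.eval t - (u0 - I0).eval t) * q.eval t = 0)
    (hT : T.degree ≤ (k : WithBot ℕ)) :
    amin / 2 * (∫ t in c..d, (Du - p).eval t ^ 2) ≤
      ((∫ t in c..d, a2 t * Du.eval t * (Du - p).eval t)
        + (∫ t in c..d, a0 t * u0.eval t * (u0 - I0).eval t)
        - ∫ t in c..d, f t * (u0 - I0).eval t)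
      - (a2 d * u1 d * E.eval d - a2 c * u1 c * E.eval c)
      + (A2 * (∫ t in c..d, (u1 t - p.eval t) ^ 2) + A0 * (∫ t in c..d, (u t - I0.eval t) ^ 2)
        + h ^ 2 / amin * ∫ t in c..d, (w t - T.eval t) ^ 2) := by
  have hle := hcd.le
  have hhp : 0 < h := by linarith
  have hfe : ∫ t in c..d, f t * (u0 - I0).eval t =
      ∫ t in c..d, (-w t + a0 t * u t) * (u0 - I0).eval t := by
    apply intervalIntegral.integral_congr_Ioo_of_le hle
    intro t ht
    simp only [hf t ht]
  have hB : ∫ t in c..d, (w t * E.eval t + a2 t * u1 t * (Du - p).eval t) =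
      a2 d * u1 d * E.eval d - a2 c * u1 c * E.eval c := by
    apply intervalIntegral.integral_eq_sub_of_hasDerivAt_of_le hle
      (f := fun t => a2 t * u1 t * E.eval t) (by fun_prop) _ (aux_ii hle (by fun_prop))
    intro t ht
    have := (hw t ht).mul (E.hasDerivAt t)
    rw [hE] at this
    exact this
  have hTo := hproj T hT
  have hEe : ∫ t in c..d, (E.eval t - (u0 - I0).eval t) ^ 2 ≤
      h ^ 2 * ∫ t in c..d, (Du - p).eval t ^ 2 := by
    have h1 := aux_best hle k E (u0 - I0) (Polynomial.C (E.eval c)) he0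
      (Polynomial.degree_C_le.trans (by positivity)) hproj
    have h2 := aux_poincare hle (F := fun t => E.eval t) (g := fun t => (Du - p).eval t)
      E.continuous.continuousOn (Du - p).continuous.continuousOn
      (fun t _ => by
        have := E.hasDerivAt t
        rwa [hE] at this)
    simp only [Polynomial.eval_C] at h1
    refine h1.trans (h2.trans ?_)
    apply mul_le_mul_of_nonneg_right
    · apply pow_le_pow_left₀ (by linarith) hh
    · exact intervalIntegral.integral_nonneg hle (fun t _ => sq_nonneg _)
  have hmain : ∫ t in c..d, (3 / 4 * amin * (Du - p).eval t ^ 2 - A2 * (u1 t - p.eval t) ^ 2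
        - A0 * (u t - I0.eval t) ^ 2
        - amin / (4 * h ^ 2) * (E.eval t - (u0 - I0).eval t) ^ 2
        - h ^ 2 / amin * (w t - T.eval t) ^ 2) ≤
      ∫ t in c..d, (a2 t * Du.eval t * (Du - p).eval t + a0 t * u0.eval t * (u0 - I0).eval t
        - (-w t + a0 t * u t) * (u0 - I0).eval t
        - (w t * E.eval t + a2 t * u1 t * (Du - p).eval t)
        + (E.eval t - (u0 - I0).eval t) * T.eval t) := by
    apply intervalIntegral.integral_mono_on hle (aux_ii hle (by fun_prop))
      (aux_ii hle (by fun_prop))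
    intro t ht
    obtain ⟨b1, b2⟩ := ba2 t ht
    obtain ⟨b3, b4⟩ := ba0 t ht
    simp only [Polynomial.eval_sub]
    set D := Du.eval t - p.eval t with hD
    set g := u1 t - p.eval t with hg
    set e := u0.eval t - I0.eval t with he
    set r := u t - I0.eval t with hr
    set y := E.eval t - e with hy
    set z := w t - T.eval t with hz
    have i1 : 3 / 4 * amin * D ^ 2 - A2 * g ^ 2 ≤ a2 t * (D - g) * D := by
      have j1 : a2 t * (3 / 4 * D ^ 2 - g ^ 2) ≤ a2 t * ((D - g) * D) := by
        apply mul_le_mul_of_nonneg_left _ (by linarith)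
        nlinarith [sq_nonneg (D / 2 - g)]
      have j2 : amin * D ^ 2 ≤ a2 t * D ^ 2 := mul_le_mul_of_nonneg_right b1 (sq_nonneg _)
      have j3 : a2 t * g ^ 2 ≤ A2 * g ^ 2 := mul_le_mul_of_nonneg_right b2 (sq_nonneg _)
      nlinarith
    have i2 : - (A0 * r ^ 2) ≤ a0 t * (e - r) * e := by
      have j1 : a0 t * (- r ^ 2) ≤ a0 t * ((e - r) * e) := by
        apply mul_le_mul_of_nonneg_left _ b3
        nlinarith [sq_nonneg (e - r / 2), sq_nonneg r]
      have j3 : a0 t * r ^ 2 ≤ A0 * r ^ 2 := mul_le_mul_of_nonneg_right b4 (sq_nonneg _)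
      nlinarith
    have i3 : z * y ≤ amin / (4 * h ^ 2) * y ^ 2 + h ^ 2 / amin * z ^ 2 := by
      have : amin / (4 * h ^ 2) * y ^ 2 + h ^ 2 / amin * z ^ 2 - z * y =
          amin * (y / (2 * h) - h / amin * z) ^ 2 := by
        field_simp; ring
      have h2 : 0 ≤ amin * (y / (2 * h) - h / amin * z) ^ 2 := by positivity
      linarith
    have i4 : a2 t * Du.eval t * D + a0 t * u0.eval t * e - (-w t + a0 t * u t) * e
        - (w t * E.eval t + a2 t * u1 t * D) + y * T.eval t =
        a2 t * (D - g) * D + a0 t * (e - r) * e - z * y := by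
      have e1 : Du.eval t = D + p.eval t := by rw [hD]; ring
      have e2 : u1 t = g + p.eval t := by rw [hg]; ring
      have e3 : u0.eval t = e + I0.eval t := by rw [he]; ring
      have e4 : u t = r + I0.eval t := by rw [hr]; ring
      have e5 : E.eval t = y + e := by rw [hy]; ring
      have e6 : w t = z + T.eval t := by rw [hz]; ring
      rw [e1, e2, e3, e4, e5, e6]; ring
    rw [i4]
    linarith
  rw [intervalIntegral.integral_sub (aux_ii hle (by fun_prop)) (aux_ii hle (by fun_prop)),
    intervalIntegral.integral_sub (aux_ii hle (by fun_prop)) (aux_ii hle (by fun_prop)),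
    intervalIntegral.integral_sub (aux_ii hle (by fun_prop)) (aux_ii hle (by fun_prop)),
    intervalIntegral.integral_sub (aux_ii hle (by fun_prop)) (aux_ii hle (by fun_prop)),
    intervalIntegral.integral_add (aux_ii hle (by fun_prop)) (aux_ii hle (by fun_prop)),
    intervalIntegral.integral_sub (aux_ii hle (by fun_prop)) (aux_ii hle (by fun_prop)),
    intervalIntegral.integral_sub (aux_ii hle (by fun_prop)) (aux_ii hle (by fun_prop)),
    intervalIntegral.integral_add (aux_ii hle (by fun_prop)) (aux_ii hle (by fun_prop)),
    intervalIntegral.integral_const_mul, intervalIntegral.integral_const_mul,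
    intervalIntegral.integral_const_mul, intervalIntegral.integral_const_mul,
    intervalIntegral.integral_const_mul, hB, hTo, ← hfe] at hmain
  have hq : amin / (4 * h ^ 2) * (∫ t in c..d, (E.eval t - (u0 - I0).eval t) ^ 2) ≤
      amin / 4 * ∫ t in c..d, (Du - p).eval t ^ 2 := by
    refine (mul_le_mul_of_nonneg_left hEe (by positivity)).trans (le_of_eq ?_)
    field_simp
  linarith

theorem aux_part {n : ℕ} {x : ℕ → ℝ} (hx : ∀ i < n, x i < x (i + 1)) :
    ∀ i ≤ n, x 0 ≤ x i ∧ x i ≤ x n := by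
  have h1 : ∀ i ≤ n, x 0 ≤ x i := by
    intro i
    induction i with
    | zero => intro _; exact le_rfl
    | succ i ih => intro hi; exact (ih (by omega)).trans (hx i (by omega)).le
  have h2 : ∀ m i, i + m = n → x i ≤ x n := by
    intro m
    induction m with
    | zero => intro i hi; simp at hi; rw [hi]
    | succ m ih => intro i hi; exact (hx i (by omega)).le.trans (ih (i + 1) (by omega))
  intro i hi
  exact ⟨h1 i hi, h2 (n - i) i (by omega)⟩

theorem aux_nodal {n : ℕ} {a b : ℝ} {x : ℕ → ℝ} (hx0 : x 0 = a) (hxn : x n = b)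
    (hx : ∀ i < n, x i < x (i + 1)) {u u1 : ℝ → ℝ}
    (cu : ContinuousOn u (Icc a b)) (cu1 : ContinuousOn u1 (Icc a b))
    (hu : ∀ t ∈ Ioo a b, HasDerivAt u (u1 t) t) (D : ℕ → Polynomial ℝ) (vn : ℕ → ℝ)
    (hv0 : vn 0 = u a) (hv : ∀ i < n, vn (i + 1) - vn i = ∫ t in x i..x (i + 1), (D i).eval t) :
    ∀ i ≤ n, (vn i - u (x i)) ^ 2 ≤
      (b - a) * ∑ j ∈ Finset.range n, ∫ t in x j..x (j + 1), (u1 t - (D j).eval t) ^ 2 := by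
  have hp := aux_part hx
  have hsub : ∀ i < n, Icc (x i) (x (i + 1)) ⊆ Icc a b := by
    intro i hi
    rw [← hx0, ← hxn]
    exact Icc_subset_Icc (hp i hi.le).1 (hp (i + 1) hi).2
  have hnn : ∀ j < n, 0 ≤ ∫ t in x j..x (j + 1), (u1 t - (D j).eval t) ^ 2 := fun j hj =>
    intervalIntegral.integral_nonneg (hx j hj).le (fun t _ => sq_nonneg _)
  have h1 : ∀ i ≤ n, u (x i) - vn i =
      ∑ j ∈ Finset.range i, ∫ t in x j..x (j + 1), (u1 t - (D j).eval t) := by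
    intro i
    induction i with
    | zero => intro _; simp [hv0, hx0]
    | succ i ih =>
      intro hi
      have hlt := hx i (by omega)
      have hs := hsub i (by omega)
      rw [Finset.sum_range_succ, ← ih (by omega),
        intervalIntegral.integral_sub (aux_ii hlt.le (cu1.mono hs))
          ((D i).continuous.intervalIntegrable _ _), ← hv i (by omega),
        intervalIntegral.integral_eq_sub_of_hasDerivAt_of_le hlt.le (cu.mono hs)
          (fun t ht => hu t ⟨?_, ?_⟩) (aux_ii hlt.le (cu1.mono hs))]
      · ring
      · exact (hs (left_mem_Icc.2 hlt.le)).1.trans_lt ht.1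
      · exact ht.2.trans_le (hs (right_mem_Icc.2 hlt.le)).2
  intro i hi
  have h2 : (vn i - u (x i)) ^ 2 = (u (x i) - vn i) ^ 2 := by ring
  rw [h2, h1 i hi]
  refine (Finset.sum_sq_le_sum_mul_sum_of_sq_le_mul (Finset.range i)
    (f := fun j => x (j + 1) - x j)
    (g := fun j => ∫ t in x j..x (j + 1), (u1 t - (D j).eval t) ^ 2) ?_ ?_ ?_).trans ?_
  · intro j hj
    have := hx j (by have := Finset.mem_range.1 hj; omega)
    linarith
  · intro j hj
    exact hnn j (by have := Finset.mem_range.1 hj; omega)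
  · intro j hj
    have hj' : j < n := by have := Finset.mem_range.1 hj; omega
    exact aux_cs (hx j hj').le ((cu1.mono (hsub j hj')).sub (D j).continuous.continuousOn)
  · rw [Finset.sum_range_sub]
    apply mul_le_mul
    · rw [hx0]; have := (hp i hi).2; rw [hxn] at this; linarith
    · apply Finset.sum_le_sum_of_subset_of_nonneg
      · intro j hj
        have := Finset.mem_range.1 hj
        exact Finset.mem_range.2 (by omega)
      · intro j hj _
        exact hnn j (Finset.mem_range.1 hj)
    · apply Finset.sum_nonneg
      intro j hj
      exact hnn j (by have := Finset.mem_range.1 hj; omega)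
    · have := (hp n le_rfl).1
      rw [hx0, hxn] at this; linarith

/-- Elementwise bound of `u - I0` where `I0` is the projection of `P`. -/
theorem aux_uI {c d : ℝ} (hcd : c ≤ d) (k : ℕ) {u : ℝ → ℝ} (cu : ContinuousOn u (Icc c d))
    (P I0 R : Polynomial ℝ) (hI : I0.degree ≤ (k : WithBot ℕ)) (hR : R.degree ≤ (k : WithBot ℕ))
    (hproj : ∀ q : Polynomial ℝ, q.degree ≤ (k : WithBot ℕ) →
      ∫ t in c..d, (P.eval t - I0.eval t) * q.eval t = 0) :
    ∫ t in c..d, (u t - I0.eval t) ^ 2 ≤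
      6 * (∫ t in c..d, (u t - P.eval t) ^ 2) + 4 * ∫ t in c..d, (u t - R.eval t) ^ 2 := by
  have h0 := aux_best hcd k P I0 R hI hR hproj
  have h1 : ∫ t in c..d, (u t - I0.eval t) ^ 2 ≤
      ∫ t in c..d, (2 * (u t - P.eval t) ^ 2 + 2 * (P.eval t - I0.eval t) ^ 2) := by
    apply intervalIntegral.integral_mono_on hcd (aux_ii hcd (by fun_prop))
      (aux_ii hcd (by fun_prop))
    intro t _
    nlinarith [sq_nonneg ((u t - P.eval t) - (P.eval t - I0.eval t))]
  have h2 : ∫ t in c..d, (P.eval t - R.eval t) ^ 2 ≤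
      ∫ t in c..d, (2 * (u t - P.eval t) ^ 2 + 2 * (u t - R.eval t) ^ 2) := by
    apply intervalIntegral.integral_mono_on hcd (aux_ii hcd (by fun_prop))
      (aux_ii hcd (by fun_prop))
    intro t _
    nlinarith [sq_nonneg ((u t - P.eval t) + (u t - R.eval t))]
  rw [intervalIntegral.integral_add (aux_ii hcd (by fun_prop)) (aux_ii hcd (by fun_prop)),
    intervalIntegral.integral_const_mul, intervalIntegral.integral_const_mul] at h1 h2
  linarith

theorem aux_core {k s n : ℕ} (hs : s ≤ k) {a b amin A2 A0 K h : ℝ} (hab : a < b)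
    (hamin : 0 < amin) (hA2 : 0 ≤ A2) (hA0 : 0 ≤ A0) (hK : 0 ≤ K) {x : ℕ → ℝ}
    (hx0 : x 0 = a) (hxn : x n = b) (hx : ∀ i < n, x i < x (i + 1))
    (hh : ∀ i < n, x (i + 1) - x i ≤ h) (hhp : 0 < h)
    {a2 a0 f : ℝ → ℝ} {U W : ℕ → ℝ → ℝ}
    (ca2 : ContinuousOn a2 (Icc a b)) (ca0 : ContinuousOn a0 (Icc a b))
    (cU : ∀ j ≤ s + 2, ContinuousOn (U j) (Icc a b))
    (dU : ∀ j < s + 2, ∀ t ∈ Ioo a b, HasDerivAt (U j) (U (j + 1) t) t)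
    (cW : ∀ j ≤ s, ContinuousOn (W j) (Icc a b))
    (dW : ∀ j < s, ∀ t ∈ Ioo a b, HasDerivAt (W j) (W (j + 1) t) t)
    (hw : ∀ t ∈ Ioo a b, HasDerivAt (fun t => a2 t * U 1 t) (W 0 t) t)
    (hWK : ∀ t ∈ Icc a b, W s t ^ 2 ≤ K * ∑ j ∈ Finset.range (s + 3), U j t ^ 2)
    (hf : ∀ t ∈ Ioo a b, f t = -W 0 t + a0 t * U 0 t)
    (hua : U 0 a = 0) (hub : U 1 b = 0)
    (ba2 : ∀ t ∈ Icc a b, amin ≤ a2 t ∧ a2 t ≤ A2)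
    (ba0 : ∀ t ∈ Icc a b, 0 ≤ a0 t ∧ a0 t ≤ A0)
    {u0 : ℕ → Polynomial ℝ} {un : ℕ → ℝ} {Du : ℕ → Polynomial ℝ}
    (hsol : IsWFESol k (k + 1) (n + 1) x a2 a0 f u0 un Du) :
    ∀ i ≤ n, (un i - U 0 (x i)) ^ 2 ≤
      (b - a) * ((4 / amin * (A2 + A0 * (24 * (b - a) ^ 2 + 4) + K / amin) + 2) *
        (h ^ (2 * (s + 1)) *
          ∫ t in a..b, ∑ j ∈ Finset.range (s + 3), U j t ^ 2)) := by
  obtain ⟨⟨hu0, hun0⟩, hDu, heq⟩ := hsol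
  simp only [Nat.add_sub_cancel] at hu0 hDu heq
  unfold IsWeakDerivFam at hDu heq
  simp only [Nat.add_sub_cancel] at hDu heq
  have hp := aux_part hx
  have hsub : ∀ i < n, Icc (x i) (x (i + 1)) ⊆ Icc a b := by
    intro i hi
    rw [← hx0, ← hxn]
    exact Icc_subset_Icc (hp i hi.le).1 (hp (i + 1) hi).2
  have hsubo : ∀ i < n, Ioo (x i) (x (i + 1)) ⊆ Ioo a b := by
    intro i hi
    rw [← hx0, ← hxn]
    exact Ioo_subset_Ioo (hp i hi.le).1 (hp (i + 1) hi).2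
  set S : ℝ → ℝ := fun t => ∑ j ∈ Finset.range (s + 3), U j t ^ 2 with hS
  have cS : ContinuousOn S (Icc a b) := by
    apply continuousOn_finsetSum
    intro j hj
    exact (cU j (by have := Finset.mem_range.1 hj; omega)).pow 2
  have hUS : ∀ j ≤ s + 2, ∀ t, U j t ^ 2 ≤ S t := by
    intro j hj t
    exact Finset.single_le_sum (f := fun j => U j t ^ 2) (fun _ _ => sq_nonneg _)
      (Finset.mem_range.2 (by omega))
  have hSnn : ∀ t, 0 ≤ S t := fun t => Finset.sum_nonneg (fun _ _ => sq_nonneg _)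
  set Sg := ∫ t in a..b, S t with hSg
  have hSum : ∑ i ∈ Finset.range n, ∫ t in x i..x (i + 1), S t = Sg := by
    rw [intervalIntegral.sum_integral_adjacent_intervals
      (fun i hi => aux_ii (hx i hi).le (cS.mono (hsub i hi))), hx0, hxn]
  have hSi : ∀ i < n, 0 ≤ ∫ t in x i..x (i + 1), S t := fun i hi =>
    intervalIntegral.integral_nonneg (hx i hi).le (fun t _ => hSnn t)
  -- generic approximation on an element
  have happ : ∀ (m : ℕ) (G : ℕ → ℝ → ℝ) (L : ℝ), 0 ≤ L →
      (∀ j ≤ m, ContinuousOn (G j) (Icc a b)) →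
      (∀ j < m, ∀ t ∈ Ioo a b, HasDerivAt (G j) (G (j + 1) t) t) →
      (∀ t ∈ Icc a b, G m t ^ 2 ≤ L * S t) →
      ∀ i, ∃ T : Polynomial ℝ, i < n → T.degree < (m : WithBot ℕ) ∧
        ∫ t in x i..x (i + 1), (G 0 t - T.eval t) ^ 2 ≤
          h ^ (2 * m) * (L * ∫ t in x i..x (i + 1), S t) := by
    intro m G L hL cG dG bG i
    by_cases hi : i < n
    swap
    · exact ⟨0, fun h => absurd h hi⟩
    have hle := (hx i hi).le
    obtain ⟨T, hT, hTe⟩ := aux_taylor hle m G (fun j hj => (cG j hj).mono (hsub i hi))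
      (fun j hj t ht => dG j hj t (hsubo i hi ht))
    refine ⟨T, fun _ => ⟨hT, hTe.trans ?_⟩⟩
    have h1 : ∫ t in x i..x (i + 1), G m t ^ 2 ≤ L * ∫ t in x i..x (i + 1), S t := by
      rw [← intervalIntegral.integral_const_mul]
      apply intervalIntegral.integral_mono_on hle
        (aux_ii hle (((cG m le_rfl).mono (hsub i hi)).pow 2))
        (aux_ii hle (continuousOn_const.mul (cS.mono (hsub i hi))))
      intro t ht
      exact bG t (hsub i hi ht)
    apply mul_le_mul _ h1 (intervalIntegral.integral_nonneg hle (fun t _ => sq_nonneg _))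
      (by positivity)
    exact pow_le_pow_left₀ (by linarith) (hh i hi) _
  choose p hpp using happ (s + 1) (fun j => U (j + 1)) 1 zero_le_one
    (fun j hj => cU _ (by omega)) (fun j hj => dU _ (by omega))
    (fun t _ => by rw [one_mul]; exact hUS _ (by omega) t)
  choose R hRR using happ (s + 1) U 1 zero_le_one
    (fun j hj => cU _ (by omega)) (fun j hj => dU _ (by omega))
    (fun t _ => by rw [one_mul]; exact hUS _ (by omega) t)
  choose T hTT using happ s W K hK cW dW hWK
  simp only [zero_add, one_mul] at hpp hRR
  have hmono : ∀ {q : Polynomial ℝ} {m l : ℕ}, m ≤ l + 1 → q.degree < (m : WithBot ℕ) →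
      q.degree ≤ (l : WithBot ℕ) := by
    intro q m l hml hq
    rw [aux_deg_iff]
    exact hq.trans_le (by exact_mod_cast hml)
  -- the interpolant
  set In : ℕ → ℝ := fun i => ∑ j ∈ Finset.range i, ∫ t in x j..x (j + 1), (p j).eval t with hIn
  have hPex : ∀ i, ∃ P : Polynomial ℝ, P.derivative = p i ∧ P.eval (x i) = In i := by
    intro i
    obtain ⟨P, h1, h2, -⟩ := aux_anti (p i) ((p i).natDegree + 1)
      (Polynomial.degree_le_natDegree.trans_lt (by exact_mod_cast Nat.lt_succ_self _)) (x i) (In i)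
    exact ⟨P, h1, h2⟩
  choose P hPd hPx using hPex
  have hPx' : ∀ i < n, (P i).eval (x (i + 1)) = In (i + 1) := by
    intro i hi
    have h1 := intervalIntegral.integral_eq_sub_of_hasDerivAt (a := x i) (b := x (i + 1))
      (f := fun t => (P i).eval t) (f' := fun t => (p i).eval t)
      (fun t _ => by
        have := (P i).hasDerivAt t
        rwa [hPd] at this) ((p i).continuous.intervalIntegrable _ _)
    simp only [hIn, Finset.sum_range_succ] at hPx ⊢
    rw [h1, hPx]; ring
  have hIex : ∀ i, ∃ I0 : Polynomial ℝ, i < n → I0.degree ≤ (k : WithBot ℕ) ∧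
      ∀ q : Polynomial ℝ, q.degree ≤ (k : WithBot ℕ) →
        ∫ t in x i..x (i + 1), ((P i).eval t - I0.eval t) * q.eval t = 0 := by
    intro i
    by_cases hi : i < n
    · obtain ⟨I0, h1⟩ := aux_proj (hx i hi) k (P i)
      exact ⟨I0, fun _ => h1⟩
    · exact ⟨0, fun h => absurd h hi⟩
  choose I0 hI using hIex
  have hIw : ∀ i < n, IsWeakDeriv (k + 1) (x i) (x (i + 1)) (fun t => (I0 i).eval t) (In i)
      (In (i + 1)) (p i) := by
    intro i hi
    rw [← hPx i, ← hPx' i hi]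
    exact aux_wd' k (hmono (by omega) (hpp i hi).1) (hPd i) (hI i hi).2
  -- the discrete error
  have hew : ∀ i < n, IsWeakDeriv (k + 1) (x i) (x (i + 1)) (fun t => (u0 i - I0 i).eval t)
      (un i - In i) (un (i + 1) - In (i + 1)) (Du i - p i) := fun i hi =>
    aux_wd_sub _ (hDu i hi) (hIw i hi)
  have hedeg : ∀ i < n, (u0 i - I0 i).degree ≤ (k : WithBot ℕ) := fun i hi =>
    (Polynomial.degree_sub_le _ _).trans (max_le (hu0 i hi) (hI i hi).1)
  have hEex : ∀ i, ∃ E : Polynomial ℝ, E.derivative = Du i - p i ∧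
      E.eval (x i) = un i - In i := by
    intro i
    obtain ⟨E, h1, h2, -⟩ := aux_anti (Du i - p i) ((Du i - p i).natDegree + 1)
      (Polynomial.degree_le_natDegree.trans_lt (by exact_mod_cast Nat.lt_succ_self _)) (x i)
      (un i - In i)
    exact ⟨E, h1, h2⟩
  choose E hEd hEx using hEex
  have hEw := fun i hi => aux_wd k (hew i hi) (hEd i) (hEx i)
  have hIn0 : In 0 = 0 := by simp [hIn]
  have hen := heq (fun i => u0 i - I0 i) (fun i => un i - In i) (fun i => Du i - p i)
    ⟨hedeg, by simp [hun0, hIn0]⟩ hew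
  have hel := fun i (hi : i < n) => aux_elem (f := f) (hx i hi) (hh i hi) hamin k
    (ca2.mono (hsub i hi))
    (ca0.mono (hsub i hi)) ((cU 0 (by omega)).mono (hsub i hi)) ((cU 1 (by omega)).mono (hsub i hi))
    ((cW 0 (by omega)).mono (hsub i hi)) (fun t ht => hw t (hsubo i hi ht))
    (fun t ht => hf t (hsubo i hi ht)) (fun t ht => ba2 t (hsub i hi ht))
    (fun t ht => ba0 t (hsub i hi ht)) (Du i) (p i) (u0 i) (I0 i) (E i) (T i) (hEd i)
    (hedeg i hi) (hEw i hi).2 (hmono (by omega) (hTT i hi).1)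
  -- sums
  set Y := ∑ i ∈ Finset.range n, ∫ t in x i..x (i + 1), (U 1 t - (p i).eval t) ^ 2 with hY
  have hYle : Y ≤ h ^ (2 * (s + 1)) * Sg := by
    rw [← hSum, Finset.mul_sum]
    exact Finset.sum_le_sum (fun i hi => (hpp i (Finset.mem_range.1 hi)).2)
  have hRle : ∑ i ∈ Finset.range n, ∫ t in x i..x (i + 1), (U 0 t - (R i).eval t) ^ 2 ≤
      h ^ (2 * (s + 1)) * Sg := by
    rw [← hSum, Finset.mul_sum]
    exact Finset.sum_le_sum (fun i hi => (hRR i (Finset.mem_range.1 hi)).2)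
  have hTle : ∑ i ∈ Finset.range n, ∫ t in x i..x (i + 1), (W 0 t - (T i).eval t) ^ 2 ≤
      h ^ (2 * s) * (K * Sg) := by
    rw [← hSum, Finset.mul_sum, Finset.mul_sum]
    exact Finset.sum_le_sum (fun i hi => (hTT i (Finset.mem_range.1 hi)).2)
  have hYi : ∀ i < n, ∫ t in x i..x (i + 1), (U 1 t - (p i).eval t) ^ 2 ≤ Y := by
    intro i hi
    exact Finset.single_le_sum
      (f := fun i => ∫ t in x i..x (i + 1), (U 1 t - (p i).eval t) ^ 2)
      (fun j hj => intervalIntegral.integral_nonneg (hx j (Finset.mem_range.1 hj)).le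
        (fun t _ => sq_nonneg _)) (Finset.mem_range.2 hi)
  have hInode := aux_nodal hx0 hxn hx (cU 0 (by omega)) (cU 1 (by omega)) (dU 0 (by omega)) p In
    (by rw [hIn0, hua]) (fun i hi => by simp only [hIn, Finset.sum_range_succ]; ring)
  rw [← hY] at hInode
  have hY0 : 0 ≤ Y := Finset.sum_nonneg (fun j hj =>
    intervalIntegral.integral_nonneg (hx j (Finset.mem_range.1 hj)).le (fun t _ => sq_nonneg _))
  have hPle : ∑ i ∈ Finset.range n, ∫ t in x i..x (i + 1), (U 0 t - (P i).eval t) ^ 2 ≤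
      4 * (b - a) ^ 2 * Y := by
    have h1 : ∀ i ∈ Finset.range n, ∫ t in x i..x (i + 1), (U 0 t - (P i).eval t) ^ 2 ≤
        (x (i + 1) - x i) * (4 * (b - a) * Y) := by
      intro i hi
      have hi' := Finset.mem_range.1 hi
      have hle := (hx i hi').le
      have c0 := (cU 0 (by omega)).mono (hsub i hi')
      rw [← smul_eq_mul, ← intervalIntegral.integral_const]
      apply intervalIntegral.integral_mono_on hle (aux_ii hle (by fun_prop))
        (aux_ii hle (by fun_prop))
      intro t ht
      have h2 := aux_pt hle (F := fun t => U 0 t - (P i).eval t)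
        (g := fun t => U 1 t - (p i).eval t) (c0.sub (P i).continuous.continuousOn)
        (((cU 1 (by omega)).mono (hsub i hi')).sub (p i).continuous.continuousOn)
        (fun t ht => by
          have := (dU 0 (by omega) t (hsubo i hi' ht)).sub ((P i).hasDerivAt t)
          rw [hPd] at this
          exact this) ht
      have h3 := hInode i hi'.le
      rw [hPx] at h2
      have h4 : (x (i + 1) - x i) * ∫ t in x i..x (i + 1), (U 1 t - (p i).eval t) ^ 2 ≤
          (b - a) * Y := by
        apply mul_le_mul _ (hYi i hi')
          (intervalIntegral.integral_nonneg hle (fun t _ => sq_nonneg _)) (by linarith)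
        have e1 := (hsub i hi' (left_mem_Icc.2 hle)).1
        have e2 := (hsub i hi' (right_mem_Icc.2 hle)).2
        linarith
      have h5 := h2.trans h4
      nlinarith [sq_nonneg ((U 0 t - (P i).eval t - (U 0 (x i) - In i)) + (In i - U 0 (x i)))]
    refine (Finset.sum_le_sum h1).trans (le_of_eq ?_)
    rw [← Finset.sum_mul, Finset.sum_range_sub, hx0, hxn]
    ring
  have hIle : ∑ i ∈ Finset.range n, ∫ t in x i..x (i + 1), (U 0 t - (I0 i).eval t) ^ 2 ≤
      (24 * (b - a) ^ 2 + 4) * (h ^ (2 * (s + 1)) * Sg) := by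
    have h1 : ∀ i ∈ Finset.range n, ∫ t in x i..x (i + 1), (U 0 t - (I0 i).eval t) ^ 2 ≤
        6 * (∫ t in x i..x (i + 1), (U 0 t - (P i).eval t) ^ 2) +
          4 * ∫ t in x i..x (i + 1), (U 0 t - (R i).eval t) ^ 2 := by
      intro i hi
      have hi' := Finset.mem_range.1 hi
      exact aux_uI (hx i hi').le k ((cU 0 (by omega)).mono (hsub i hi')) (P i) (I0 i) (R i)
        (hI i hi').1 (hmono (by omega) (hRR i hi').1) (hI i hi').2
    refine (Finset.sum_le_sum h1).trans ?_
    rw [Finset.sum_add_distrib, ← Finset.mul_sum, ← Finset.mul_sum]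
    have h2 : 4 * (b - a) ^ 2 * Y ≤ 4 * (b - a) ^ 2 * (h ^ (2 * (s + 1)) * Sg) :=
      mul_le_mul_of_nonneg_left hYle (by positivity)
    linarith
  set X := ∑ i ∈ Finset.range n, ∫ t in x i..x (i + 1), (Du i - p i).eval t ^ 2 with hX
  have hXle : amin / 2 * X ≤ A2 * (h ^ (2 * (s + 1)) * Sg) +
      A0 * ((24 * (b - a) ^ 2 + 4) * (h ^ (2 * (s + 1)) * Sg)) +
      h ^ 2 / amin * (h ^ (2 * s) * (K * Sg)) := by
    have h1 := Finset.sum_le_sum (fun i hi => hel i (Finset.mem_range.1 hi))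
    rw [← Finset.mul_sum, ← hX] at h1
    refine h1.trans ?_
    have htel : ∑ i ∈ Finset.range n, (a2 (x (i + 1)) * U 1 (x (i + 1)) * (E i).eval (x (i + 1))
        - a2 (x i) * U 1 (x i) * (E i).eval (x i)) = 0 := by
      have h2 : ∀ i ∈ Finset.range n,
          (a2 (x (i + 1)) * U 1 (x (i + 1)) * (E i).eval (x (i + 1))
            - a2 (x i) * U 1 (x i) * (E i).eval (x i)) =
          (fun i => a2 (x i) * U 1 (x i) * (un i - In i)) (i + 1) -
          (fun i => a2 (x i) * U 1 (x i) * (un i - In i)) i := by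
        intro i hi
        simp only
        rw [(hEw i (Finset.mem_range.1 hi)).1, hEx]
      rw [Finset.sum_congr rfl h2]
      refine (Finset.sum_range_sub (fun i => a2 (x i) * U 1 (x i) * (un i - In i)) n).trans ?_
      simp [hxn, hub, hun0, hIn0]
    rw [Finset.sum_add_distrib, Finset.sum_sub_distrib, Finset.sum_sub_distrib,
      Finset.sum_add_distrib, Finset.sum_add_distrib, Finset.sum_add_distrib, htel, hen,
      ← Finset.mul_sum, ← Finset.mul_sum, ← Finset.mul_sum, ← hY]
    have g1 := mul_le_mul_of_nonneg_left hYle hA2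
    have g2 := mul_le_mul_of_nonneg_left hIle hA0
    have g3 := mul_le_mul_of_nonneg_left hTle (show 0 ≤ h ^ 2 / amin by positivity)
    linarith
  have hXle' : X ≤ 2 / amin * (A2 + A0 * (24 * (b - a) ^ 2 + 4) + K / amin) *
      (h ^ (2 * (s + 1)) * Sg) := by
    have h1 : X = 2 / amin * (amin / 2 * X) := by field_simp
    rw [h1]
    refine (mul_le_mul_of_nonneg_left hXle (by positivity)).trans (le_of_eq ?_)
    ring
  have hZ : ∑ i ∈ Finset.range n, ∫ t in x i..x (i + 1), (U 1 t - (Du i).eval t) ^ 2 ≤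
      2 * X + 2 * Y := by
    rw [hX, hY, Finset.mul_sum, Finset.mul_sum, ← Finset.sum_add_distrib]
    apply Finset.sum_le_sum
    intro i hi
    have hi' := Finset.mem_range.1 hi
    have hle := (hx i hi').le
    have c1 := (cU 1 (by omega)).mono (hsub i hi')
    rw [← intervalIntegral.integral_const_mul, ← intervalIntegral.integral_const_mul,
      ← intervalIntegral.integral_add (aux_ii hle (by fun_prop)) (aux_ii hle (by fun_prop))]
    apply intervalIntegral.integral_mono_on hle (aux_ii hle (by fun_prop))
      (aux_ii hle (by fun_prop))
    intro t _
    simp only [Polynomial.eval_sub]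
    nlinarith [sq_nonneg ((Du i).eval t - (p i).eval t + (U 1 t - (p i).eval t))]
  intro i hi
  have hfin := aux_nodal hx0 hxn hx (cU 0 (by omega)) (cU 1 (by omega)) (dU 0 (by omega)) Du un
    (by rw [hun0, hua]) (fun i hi => by
      have := (hDu i hi).2 1 (Polynomial.degree_one_le.trans (by positivity))
      simp at this
      linarith) i hi
  refine hfin.trans (mul_le_mul_of_nonneg_left (hZ.trans ?_) (by linarith))
  calc 2 * X + 2 * Y ≤ 2 * (2 / amin * (A2 + A0 * (24 * (b - a) ^ 2 + 4) + K / amin) *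
      (h ^ (2 * (s + 1)) * Sg)) + 2 * (h ^ (2 * (s + 1)) * Sg) := by linarith
    _ = _ := by ring

/-- Theorem 4.4, estimate (4.17). Let `k ≥ 0`, `r = k + 1`, `0 ≤ s ≤ k`.
Suppose `a2 ∈ C^{s+1}([a,b])` with `a2 ≥ a_min > 0` and `a0` continuous, nonnegative.
There is a constant `C > 0` independent of the partition such that for every partition with
mesh size `h`, if `u ∈ C^{s+2}([a,b])` solves the boundary value problem and `u_h ∈ S_h`
is the weak finite element solution with nodal values `un`, then
`max_{1 ≤ i ≤ N} |u_h^i − u(x_i)| ≤ C h^{s+1} ‖u‖_{s+2}`. -/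
theorem error_estimate_nodal (k s : ℕ) (hs : s ≤ k) (a b amin : ℝ) (hab : a < b)
    (hamin : 0 < amin) (a2 a0 : ℝ → ℝ)
    (ha2 : ContDiffOn ℝ (s + 1) a2 (Set.Icc a b)) (ha2lb : ∀ t ∈ Set.Icc a b, amin ≤ a2 t)
    (ha0c : ContinuousOn a0 (Set.Icc a b)) (ha0nn : ∀ t ∈ Set.Icc a b, 0 ≤ a0 t) :
    ∃ C > (0 : ℝ), ∀ (N : ℕ) (x : ℕ → ℝ), IsPartition N a b x →
      ∀ h : ℝ, (∀ i < N - 1, x (i + 1) - x i ≤ h) →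
      ∀ f u : ℝ → ℝ, ContDiffOn ℝ (s + 2) u (Set.Icc a b) → SolvesBVP a b a2 a0 f u →
      ∀ (u0 : ℕ → Polynomial ℝ) (un : ℕ → ℝ) (Du : ℕ → Polynomial ℝ),
        IsWFESol k (k + 1) N x a2 a0 f u0 un Du →
        ∀ i < N, |un i - u (x i)| ≤ C * h ^ (s + 1) * sobNorm (s + 2) a b u := by
  classical
  have hud : UniqueDiffOn ℝ (Icc a b) := uniqueDiffOn_Icc hab
  -- bounds for the coefficients
  have hM : ∀ i, ∃ M : ℝ, i ≤ s + 1 →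
      ∀ t ∈ Icc a b, |iteratedDerivWithin i a2 (Icc a b) t| ≤ M := by
    intro i
    by_cases hi : i ≤ s + 1
    · have hc : ContinuousOn (iteratedDerivWithin i a2 (Icc a b)) (Icc a b) :=
        ha2.continuousOn_iteratedDerivWithin (by exact_mod_cast hi) hud
      obtain ⟨M, hM⟩ := isCompact_Icc.exists_bound_of_continuousOn hc
      exact ⟨M, fun _ t ht => hM t ht⟩
    · exact ⟨0, fun h => absurd h hi⟩
  choose M hM using hM
  obtain ⟨A2, hA2⟩ := isCompact_Icc.exists_bound_of_continuousOn ha2.continuousOn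
  obtain ⟨A0, hA0⟩ := isCompact_Icc.exists_bound_of_continuousOn ha0c
  have haI : a ∈ Icc a b := left_mem_Icc.2 hab.le
  have hA2' : 0 ≤ A2 := (norm_nonneg _).trans (hA2 a haI)
  have hA0' : 0 ≤ A0 := (norm_nonneg _).trans (hA0 a haI)
  set K : ℝ := (∑ i ∈ Finset.range (s + 2), (((s + 1).choose i : ℝ) * M i) ^ 2) * (s + 2) with hK
  have hK0 : 0 ≤ K := mul_nonneg (Finset.sum_nonneg (fun _ _ => sq_nonneg _)) (by positivity)
  set C2 : ℝ := (b - a) * (4 / amin * (A2 + A0 * (24 * (b - a) ^ 2 + 4) + K / amin) + 2) with hC2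
  have hC2p : 0 < C2 := mul_pos (by linarith) (by positivity)
  refine ⟨Real.sqrt C2, Real.sqrt_pos.2 hC2p, ?_⟩
  intro N x hpart h hh f u hu hbvp u0 un Du hsol i hi
  obtain ⟨hN, hx0, hxn, hx⟩ := hpart
  obtain ⟨n, rfl⟩ : ∃ n, N = n + 1 := ⟨N - 1, by omega⟩
  simp only [Nat.add_sub_cancel] at hxn hx hh
  have hhp : 0 < h := by
    have h1 := hx 0 (by omega)
    have h2 := hh 0 (by omega)
    linarith
  set U : ℕ → ℝ → ℝ := fun j => iteratedDerivWithin j u (Icc a b) with hU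
  set φ : ℝ → ℝ := a2 * derivWithin u (Icc a b) with hφ
  set W : ℕ → ℝ → ℝ := fun j => iteratedDerivWithin (j + 1) φ (Icc a b) with hW
  have hu' : ContDiffOn ℝ (s + 1) (derivWithin u (Icc a b)) (Icc a b) :=
    hu.derivWithin hud (by rw [add_assoc, one_add_one_eq_two])
  have hφc : ContDiffOn ℝ (s + 1) φ (Icc a b) := ha2.mul hu'
  have key : ∀ {g : ℝ → ℝ} {m : ℕ} {l : WithTop ℕ∞}, ContDiffOn ℝ l g (Icc a b) →
      (m : WithTop ℕ∞) < l → ∀ t ∈ Ioo a b,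
      HasDerivAt (iteratedDerivWithin m g (Icc a b)) (iteratedDerivWithin (m + 1) g (Icc a b) t)
        t := by
    intro g m l hg hm t ht
    have h1 := hg.differentiableOn_iteratedDerivWithin hm hud t (Ioo_subset_Icc_self ht)
    rw [iteratedDerivWithin_succ]
    exact h1.hasDerivWithinAt.hasDerivAt (Icc_mem_nhds ht.1 ht.2)
  have cU : ∀ j ≤ s + 2, ContinuousOn (U j) (Icc a b) := fun j hj =>
    hu.continuousOn_iteratedDerivWithin (by exact_mod_cast hj) hud
  have hU0 : U 0 = u := by simp [hU]
  have hU1 : U 1 = derivWithin u (Icc a b) := by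
    simp only [hU, iteratedDerivWithin_one]
  have hUs : ∀ j, iteratedDerivWithin j (derivWithin u (Icc a b)) (Icc a b) = U (j + 1) := by
    intro j
    simp only [hU, iteratedDerivWithin_succ']
  have hφU : (fun t => a2 t * U 1 t) = φ := by rw [hU1]; rfl
  have hW0 : W 0 = derivWithin φ (Icc a b) := by
    simp only [hW, zero_add, iteratedDerivWithin_one]
  have hres := aux_core (k := k) (s := s) (n := n) hs hab hamin hA2' hA0' hK0 hx0 hxn hx hh hhp
    (a2 := a2) (a0 := a0) (f := f) (U := U) (W := W) ha2.continuousOn ha0c cU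
    (fun j hj => key hu (by exact_mod_cast hj))
    (fun j hj => hφc.continuousOn_iteratedDerivWithin
      (by exact_mod_cast Nat.succ_le_succ hj) hud)
    (fun j hj => key hφc (by exact_mod_cast Nat.succ_lt_succ hj))
    (by
      intro t ht
      rw [hφU]
      have := key (m := 0) hφc (by exact_mod_cast Nat.succ_pos s) t ht
      rw [iteratedDerivWithin_zero] at this
      exact this)
    (by
      intro t ht
      have h1 : W s t = ∑ i ∈ Finset.range (s + 2), ((s + 1).choose i : ℝ) *
          iteratedDerivWithin i a2 (Icc a b) t * U (s + 1 - i + 1) t := by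
        have := iteratedDerivWithin_mul (n := s + 1) ht hud (f := a2)
          (g := derivWithin u (Icc a b)) (by exact_mod_cast ha2 t ht) (by exact_mod_cast hu' t ht)
        simp only [hUs] at this
        exact this
      have h2 : (W s t) ^ 2 ≤ (∑ i ∈ Finset.range (s + 2), (((s + 1).choose i : ℝ) * M i) ^ 2) *
          ∑ i ∈ Finset.range (s + 2), ∑ j ∈ Finset.range (s + 3), U j t ^ 2 := by
        rw [h1]
        apply Finset.sum_sq_le_sum_mul_sum_of_sq_le_mul
        · intro i _
          exact sq_nonneg _
        · intro i _
          exact Finset.sum_nonneg (fun _ _ => sq_nonneg _)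
        · intro i hi
          have hi' := Finset.mem_range.1 hi
          rw [mul_pow]
          apply mul_le_mul _ _ (sq_nonneg _) (sq_nonneg _)
          · rw [mul_pow, mul_pow]
            apply mul_le_mul_of_nonneg_left _ (sq_nonneg _)
            rw [← sq_abs]
            exact pow_le_pow_left₀ (abs_nonneg _) (hM i (by omega) t ht) 2
          · exact Finset.single_le_sum (f := fun j => U j t ^ 2) (fun _ _ => sq_nonneg _)
              (Finset.mem_range.2 (by omega))
      rw [Finset.sum_const, Finset.card_range, nsmul_eq_mul] at h2
      refine h2.trans (le_of_eq ?_)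
      rw [hK]
      push_cast
      ring)
    (by
      intro t ht
      rw [← hbvp.1 t ht, hW0, hU0]
      rfl)
    (by rw [hU0]; exact hbvp.2.1) (by rw [hU1]; exact hbvp.2.2)
    (fun t ht => ⟨ha2lb t ht, (le_abs_self _).trans (hA2 t ht)⟩)
    (fun t ht => ⟨ha0nn t ht, (le_abs_self _).trans (hA0 t ht)⟩) hsol i (by omega)
  have hint : ∫ t in a..b, ∑ j ∈ Finset.range (s + 3), U j t ^ 2 =
      ∑ j ∈ Finset.range (s + 2 + 1), ∫ t in a..b, (iteratedDerivWithin j u (Icc a b) t) ^ 2 := by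
    rw [intervalIntegral.integral_finsetSum]
    intro j hj
    exact aux_ii hab.le ((cU j (by have := Finset.mem_range.1 hj; omega)).pow 2)
  rw [hint, hU0, ← mul_assoc, ← hC2] at hres
  have hnn : 0 ≤ ∑ j ∈ Finset.range (s + 2 + 1),
      ∫ t in a..b, (iteratedDerivWithin j u (Icc a b) t) ^ 2 :=
    Finset.sum_nonneg (fun j _ => intervalIntegral.integral_nonneg hab.le (fun t _ => sq_nonneg _))
  have hR : 0 ≤ Real.sqrt C2 * h ^ (s + 1) * sobNorm (s + 2) a b u :=
    mul_nonneg (by positivity) (Real.sqrt_nonneg _)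
  apply abs_le_of_sq_le_sq _ hR
  refine hres.trans (le_of_eq ?_)
  unfold sobNorm
  rw [mul_pow, mul_pow, Real.sq_sqrt hC2p.le, Real.sq_sqrt hnn]
  ring
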